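/- Let U ⊆ V ⊆ W be subcomplexes of a cochain complex W of vector spaces over a field K, and set L_{U,V,W} = L_{U,W} ∩ L_{V,W}. If the inclusion V → W is a quasi-isomorphism, then the inclusion L_{U,V,W} → L_{U,W} and the restriction map L_{U,V,W} → L_{U,V}, f ↦ f|_V (where L_{U,V} ⊆ Hom*(V, V) is the subcomplex of maps of V preserving U), are quasi-isomorphisms. -/

import Mathlib

universe u

/-- A cochain complex of `K`-vector spaces, given by its components and its
degree-one differential.  (The condition `d ∘ d = 0` is `Cx.IsComplex`.) -/
structure Cx (K : Type u) [Field K] where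
  V : ℤ → Type u
  [acg : ∀ i, AddCommGroup (V i)]
  [mod : ∀ i, Module K (V i)]
  d : ∀ i, V i →ₗ[K] V (i + 1)

attribute [instance] Cx.acg Cx.mod

/-- Transport along an equality of degrees. -/
def castL (K : Type u) [Field K] (V : ℤ → Type u) [∀ i, AddCommGroup (V i)] [∀ i, Module K (V i)] {i j : ℤ}
    (h : i = j) : V i →ₗ[K] V j where
  toFun x := h ▸ x
  map_add' := by subst h; intros; rfl
  map_smul' := by subst h; intros; rfl

variable {K : Type u} [Field K]

/-- The differential squares to zero. -/
def Cx.IsComplex (A : Cx K) : Prop := ∀ (i : ℤ) (x : A.V i), A.d (i + 1) (A.d i x) = 0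

/-- A family of linear maps is a morphism of complexes if it commutes with the
differentials. -/
def IsChainMap (A B : Cx K) (f : ∀ i, A.V i →ₗ[K] B.V i) : Prop :=
  ∀ (i : ℤ) (x : A.V i), f (i + 1) (A.d i x) = B.d i (f i x)

/-- A morphism of complexes is a quasi-isomorphism if it induces an isomorphism on
cohomology in every degree: a cocycle of `A` whose image is a coboundary is a
coboundary, and every cocycle of `B` is, modulo coboundaries, the image of a
cocycle of `A`. -/
def IsQuasiIso (A B : Cx K) (f : ∀ i, A.V i →ₗ[K] B.V i) : Prop :=
  ∀ n : ℤ,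
    (∀ x : A.V (n + 1), A.d (n + 1) x = 0 → (∃ w, B.d n w = f (n + 1) x) →
      ∃ v, A.d n v = x) ∧
    (∀ y : B.V (n + 1), B.d (n + 1) y = 0 →
      ∃ x : A.V (n + 1), A.d (n + 1) x = 0 ∧ ∃ w, B.d n w = y - f (n + 1) x)

/-- A complex is acyclic if all its cohomology vanishes. -/
def Cx.Acyclic (A : Cx K) : Prop :=
  ∀ (n : ℤ) (x : A.V (n + 1)), A.d (n + 1) x = 0 → ∃ y, A.d n y = x


/-- The degree-`n` component `Hom^n(A, B) = Π_j Hom(A^j, B^{j+n})` of the Hom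
complex. -/
abbrev homV (A B : Cx K) (n : ℤ) : Type u := ∀ j : ℤ, A.V j →ₗ[K] B.V (j + n)

/-- The differential `δ(f) = d_B ∘ f − (−1)ⁿ f ∘ d_A` of the Hom complex. -/
def homD (A B : Cx K) (n : ℤ) : homV A B n →ₗ[K] homV A B (n + 1) where
  toFun f := fun j =>
    castL K B.V (show j + n + 1 = j + (n + 1) by omega) ∘ₗ B.d (j + n) ∘ₗ f j -
      ((-1 : K) ^ n) • (castL K B.V (show j + 1 + n = j + (n + 1) by omega) ∘ₗ
        f (j + 1) ∘ₗ A.d j)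
  map_add' f g := by
    funext j; ext x
    simp [smul_add]
    abel
  map_smul' c f := by
    funext j; ext x
    simp [smul_comm c, smul_sub]

/-- The Hom complex `Hom*(A, B)`. -/
def homCx (A B : Cx K) : Cx K where
  V n := homV A B n
  d n := homD A B n

/-- The subcomplex determined by a family of submodules preserved by the
differential. -/
def subCx (W : Cx K) (S : ∀ i, Submodule K (W.V i))
    (hS : ∀ i, ∀ x ∈ S i, W.d i x ∈ S (i + 1)) : Cx K where
  V i := ↥(S i)
  d i := (W.d i).restrict (hS i)

/-- The submodule `L_{V,W}^n ⊆ Hom^n(W, W)` of homogeneous maps preserving the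
subcomplex `S`. -/
def presSub (W : Cx K) (S : ∀ i, Submodule K (W.V i)) (n : ℤ) :
    Submodule K (homV W W n) where
  carrier := { f | ∀ j, ∀ x ∈ S j, f j x ∈ S (j + n) }
  add_mem' hf hg j x hx := by
    simpa using Submodule.add_mem _ (hf j x hx) (hg j x hx)
  zero_mem' j x hx := by simp
  smul_mem' c f hf j x hx := by
    simpa using Submodule.smul_mem _ c (hf j x hx)

lemma mem_presSub {W : Cx K} {S : ∀ i, Submodule K (W.V i)} {n : ℤ} {f : homV W W n} :
    f ∈ presSub W S n ↔ ∀ j, ∀ x ∈ S j, f j x ∈ S (j + n) := Iff.rfl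

lemma castL_mem {V : ℤ → Type u} [∀ i, AddCommGroup (V i)] [∀ i, Module K (V i)]
    (S : ∀ i, Submodule K (V i)) {i j : ℤ} (h : i = j) {x : V i} (hx : x ∈ S i) :
    castL K V h x ∈ S j := by subst h; exact hx

lemma homD_pres (W : Cx K) (S : ∀ i, Submodule K (W.V i))
    (hS : ∀ i, ∀ x ∈ S i, W.d i x ∈ S (i + 1)) (n : ℤ) :
    ∀ f ∈ presSub W S n, homD W W n f ∈ presSub W S (n + 1) := by
  intro f hf j x hx
  show (homD W W n f) j x ∈ _
  simp only [homD, LinearMap.coe_mk, AddHom.coe_mk, Pi.sub_apply, Pi.smul_apply,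
    LinearMap.sub_apply, LinearMap.smul_apply, LinearMap.comp_apply]
  exact Submodule.sub_mem _ (castL_mem S _ (hS _ _ (hf j x hx)))
    (Submodule.smul_mem _ _ (castL_mem S _ (hf (j + 1) _ (hS j x hx))))

/-- The subcomplex `L_{V,W} ⊆ Hom*(W, W)` of maps preserving `S`, as a complex. -/
def presCx (W : Cx K) (S : ∀ i, Submodule K (W.V i))
    (hS : ∀ i, ∀ x ∈ S i, W.d i x ∈ S (i + 1)) : Cx K where
  V n := ↥(presSub W S n)
  d n := (homD W W n).restrict (homD_pres W S hS n)

lemma homD_pres2 (W : Cx K) (S T : ∀ i, Submodule K (W.V i))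
    (hS : ∀ i, ∀ x ∈ S i, W.d i x ∈ S (i + 1))
    (hT : ∀ i, ∀ x ∈ T i, W.d i x ∈ T (i + 1)) (n : ℤ) :
    ∀ f ∈ presSub W S n ⊓ presSub W T n,
      homD W W n f ∈ presSub W S (n + 1) ⊓ presSub W T (n + 1) := by
  intro f hf
  rcases Submodule.mem_inf.mp hf with ⟨h1, h2⟩
  exact Submodule.mem_inf.mpr ⟨homD_pres W S hS n f h1, homD_pres W T hT n f h2⟩

/-- The subcomplex `L_{U,V,W} = L_{U,W} ∩ L_{V,W} ⊆ Hom*(W, W)` of maps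
preserving both subcomplexes, as a complex. -/
def presCx2 (W : Cx K) (S T : ∀ i, Submodule K (W.V i))
    (hS : ∀ i, ∀ x ∈ S i, W.d i x ∈ S (i + 1))
    (hT : ∀ i, ∀ x ∈ T i, W.d i x ∈ T (i + 1)) : Cx K where
  V n := ↥(presSub W S n ⊓ presSub W T n)
  d n := (homD W W n).restrict (homD_pres2 W S T hS hT n)

section
variable (W : Cx K) (SU SV : ∀ i, Submodule K (W.V i))
  (hV : ∀ i, ∀ x ∈ SV i, W.d i x ∈ SV (i + 1))

/-- `U` as a family of submodules of the subcomplex `V`. -/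
def subSub : ∀ i, Submodule K ((subCx W SV hV).V i) :=
  fun i => (SU i).comap (SV i).subtype

lemma subSub_pres (hU : ∀ i, ∀ x ∈ SU i, W.d i x ∈ SU (i + 1)) :
    ∀ i, ∀ x ∈ subSub W SU SV hV i,
      (subCx W SV hV).d i x ∈ subSub W SU SV hV (i + 1) :=
  fun i x hx => hU i x.1 hx

/-- The restriction map `L_{U,V,W} → L_{U,V}`, `f ↦ f|_V`;  the target is the
subcomplex `L_{U,V} ⊆ Hom*(V, V)` of maps of `V` preserving `U`. -/
def resMap2 (n : ℤ) : ↥(presSub W SU n ⊓ presSub W SV n) →ₗ[K]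
    ↥(presSub (subCx W SV hV) (subSub W SU SV hV) n) where
  toFun f :=
    ⟨fun j => (f.1 j).restrict ((Submodule.mem_inf.mp f.2).2 j),
      fun j x hx => (Submodule.mem_inf.mp f.2).1 j x.1 hx⟩
  map_add' f g := by
    apply Subtype.ext; funext j; apply LinearMap.ext; intro x; apply Subtype.ext; rfl
  map_smul' c f := by
    apply Subtype.ext; funext j; apply LinearMap.ext; intro x; apply Subtype.ext; rfl

end

lemma exists_shift {P : ℤ → Type u} (F : ∀ i, P (i + 1)) :
    ∃ G : ∀ i, P i, ∀ i, G (i + 1) = F i := by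
  refine ⟨fun i => (sub_add_cancel i 1) ▸ F (i - 1), fun i => ?_⟩
  have key : ∀ (a b : ℤ) (e : a = b) (e' : a + 1 = b + 1), (e' ▸ F a : P (b + 1)) = F b := by
    intro a b e e'; subst e; rfl
  exact key _ _ (by omega) _

section castlemmas
variable {V V' : ℤ → Type u} [∀ i, AddCommGroup (V i)] [∀ i, Module K (V i)]
  [∀ i, AddCommGroup (V' i)] [∀ i, Module K (V' i)]

lemma castL_rfl' {i : ℤ} (h : i = i) (x : V i) : castL K V h x = x := rfl

lemma castL_castL {i j k : ℤ} (h : i = j) (h' : j = k) (x : V i) :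
    castL K V h' (castL K V h x) = castL K V (h.trans h') x := by subst h; subst h'; rfl

lemma castL_nat (a b : ℤ → ℤ) (f : ∀ i, V (a i) →ₗ[K] V' (b i)) {i j : ℤ} (h : i = j)
    (h1 : a i = a j) (h2 : b i = b j) (x : V (a i)) :
    f j (castL K V h1 x) = castL K V' h2 (f i x) := by subst h; rfl
end castlemmas

lemma d_castL (A : Cx K) {i j : ℤ} (h : i = j) (x : A.V i) :
    A.d j (castL K A.V h x) = castL K A.V (by omega) (A.d i x) := by subst h; rfl

lemma homD_app (A B : Cx K) (n : ℤ) (f : homV A B n) (j : ℤ) (x : A.V j) :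
    homD A B n f j x = castL K B.V (show j + n + 1 = j + (n + 1) by omega) (B.d (j + n) (f j x)) -
      ((-1 : K) ^ n) • castL K B.V (show j + 1 + n = j + (n + 1) by omega) (f (j + 1) (A.d j x)) :=
  rfl

lemma coe_castL_sub (W : Cx K) (S : ∀ i, Submodule K (W.V i))
    (hS : ∀ i, ∀ x ∈ S i, W.d i x ∈ S (i + 1)) {i j : ℤ} (h : i = j) (x : S i) :
    Subtype.val (p := (· ∈ S j)) (castL K (subCx W S hS).V h x) = castL K W.V h (x : W.V i) := by
  subst h; rfl

lemma sgn_succ (n : ℤ) : (-1 : K) ^ (n + 1) = - (-1 : K) ^ n := by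
  rw [zpow_add_one₀ (by simp)]; simp

lemma sgn_sq (n : ℤ) : (-1 : K) ^ n * (-1 : K) ^ n = 1 := by
  rw [← mul_zpow]; simp

lemma acyc (W : Cx K) (hW : W.IsComplex) (S : ∀ i, Submodule K (W.V i))
    (hS : ∀ i, ∀ x ∈ S i, W.d i x ∈ S (i + 1))
    (hq : IsQuasiIso (subCx W S hS) W (fun i => (S i).subtype)) (i : ℤ) (w : W.V (i + 1))
    (hw : W.d (i + 1) w ∈ S (i + 1 + 1)) : ∃ v ∈ S (i + 1), ∃ y, w = v + W.d i y := by
  obtain ⟨v, hv⟩ := (hq (i + 1)).1 ⟨W.d (i + 1) w, hw⟩ (Subtype.ext (hW _ _)) ⟨w, rfl⟩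
  have hv' : W.d (i + 1) v.1 = W.d (i + 1) w := congrArg Subtype.val hv
  obtain ⟨v', _, y, hy⟩ := (hq i).2 (w - v.1) (by rw [map_sub, hv', sub_self])
  refine ⟨v.1 + v'.1, (S _).add_mem v.2 v'.2, y, ?_⟩
  change W.d i y = w - v.1 - v'.1 at hy
  rw [hy]
  abel

lemma exists_h (W : Cx K) (hW : W.IsComplex) (S : ∀ i, Submodule K (W.V i))
    (hS : ∀ i, ∀ x ∈ S i, W.d i x ∈ S (i + 1))
    (hq : IsQuasiIso (subCx W S hS) W (fun i => (S i).subtype)) :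
    ∃ h : ∀ i, W.V (i + 1) →ₗ[K] W.V i, (∀ i, ∀ x ∈ S (i + 1), h i x = 0) ∧
      ∀ i x, x - W.d i (h i x) - h (i + 1) (W.d (i + 1) x) ∈ S (i + 1) := by
  have hC : ∀ i, ∃ C : Submodule K (W.V i), IsCompl ((S (i + 1)).comap (W.d i)) C :=
    fun i => Submodule.exists_isCompl _
  choose C hC using hC
  have inj0 : ∀ i (c : W.V i), c ∈ C i → W.d i c ∈ S (i + 1) → c = 0 := fun i c hc hd =>
    (Submodule.disjoint_def.1 (hC i).disjoint) c hd hc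
  have dec : ∀ i (w : W.V i), ∃ z, W.d i z ∈ S (i + 1) ∧ ∃ c ∈ C i, z + c = w := by
    intro i w
    have : w ∈ (S (i + 1)).comap (W.d i) ⊔ C i := by rw [(hC i).sup_eq_top]; trivial
    obtain ⟨z, hz, c, hc, e⟩ := Submodule.mem_sup.1 this
    exact ⟨z, hz, c, hc, e⟩
  let φ : ∀ i, (S (i + 1) × C i × C (i + 1)) →ₗ[K] W.V (i + 1) := fun i =>
    (S (i + 1)).subtype.coprod ((W.d i ∘ₗ (C i).subtype).coprod (C (i + 1)).subtype)
  have φa : ∀ i v c c', φ i (v, c, c') = v.1 + (W.d i c.1 + c'.1) := fun i v c c' => by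
    simp [φ]
  have φb : ∀ i, Function.Bijective (φ i) := by
    intro i
    constructor
    · rw [← LinearMap.ker_eq_bot, LinearMap.ker_eq_bot']
      rintro ⟨v, c, c'⟩ e
      rw [φa] at e
      have h1 : c'.1 = 0 := by
        apply inj0 _ _ c'.2
        have := congrArg (W.d (i + 1)) e
        rw [map_add, map_add, hW, zero_add, map_zero] at this
        rw [eq_neg_of_add_eq_zero_right this]
        exact (S _).neg_mem (hS _ _ v.2)
      rw [h1, add_zero] at e
      have h2 : c.1 = 0 := by
        apply inj0 _ _ c.2
        rw [eq_neg_of_add_eq_zero_right e]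
        exact (S _).neg_mem v.2
      rw [h2, map_zero, add_zero] at e
      ext <;> simp [*]
    · intro w
      obtain ⟨z, hz, c', hc', rfl⟩ := dec _ w
      obtain ⟨v, hv, y, rfl⟩ := acyc W hW S hS hq i z hz
      obtain ⟨z', hz', c, hc, rfl⟩ := dec _ y
      refine ⟨(⟨v + W.d i z', (S _).add_mem hv hz'⟩, ⟨c, hc⟩, ⟨c', hc'⟩), ?_⟩
      rw [φa]
      simp only [map_add]
      abel
  let h : ∀ i, W.V (i + 1) →ₗ[K] W.V i := fun i =>
    (C i).subtype ∘ₗ LinearMap.fst K _ _ ∘ₗ LinearMap.snd K _ _ ∘ₗ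
      (LinearEquiv.ofBijective (φ i) (φb i)).symm.toLinearMap
  have hφ : ∀ i p, h i (φ i p) = p.2.1.1 := by
    intro i p
    have : (LinearEquiv.ofBijective (φ i) (φb i)).symm (φ i p) = p :=
      (LinearEquiv.ofBijective (φ i) (φb i)).symm_apply_apply p
    simp [h, this]
  have hSz : ∀ i, ∀ x ∈ S (i + 1), h i x = 0 := by
    intro i x hx
    have := hφ i (⟨x, hx⟩, 0, 0)
    rw [φa] at this
    simpa using this
  refine ⟨h, hSz, fun i x => ?_⟩
  obtain ⟨⟨v, c, c'⟩, rfl⟩ := (φb i).2 x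
  have h2 : h (i + 1) (W.d (i + 1) c'.1) = c'.1 := by
    have := hφ (i + 1) (0, c', 0)
    rw [φa] at this
    simpa using this
  rw [hφ, φa]
  have h3 : W.d (i + 1) (W.d i c.1) = 0 := hW _ _
  simp only [map_add, h3, h2, hSz _ _ (hS _ _ v.2), map_zero]
  convert v.2 using 1
  abel

lemma exists_hr (W : Cx K) (hW : W.IsComplex) (S : ∀ i, Submodule K (W.V i))
    (hS : ∀ i, ∀ x ∈ S i, W.d i x ∈ S (i + 1))
    (hq : IsQuasiIso (subCx W S hS) W (fun i => (S i).subtype)) :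
    ∃ (h : ∀ i, W.V (i + 1) →ₗ[K] W.V i) (r : ∀ i, W.V i →ₗ[K] W.V i),
      (∀ i, ∀ x ∈ S (i + 1), h i x = 0) ∧ (∀ i x, r i x ∈ S i) ∧
      (∀ i, ∀ x ∈ S i, r i x = x) ∧ (∀ i x, r (i + 1) (W.d i x) = W.d i (r i x)) ∧
      ∀ i x, W.d i (h i x) = x - r (i + 1) x - h (i + 1) (W.d (i + 1) x) := by
  obtain ⟨h, h0, h1⟩ := exists_h W hW S hS hq
  obtain ⟨r, hr⟩ := exists_shift (P := fun i => W.V i →ₗ[K] W.V i)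
    (fun i => LinearMap.id - W.d i ∘ₗ h i - h (i + 1) ∘ₗ W.d (i + 1))
  have hr' : ∀ i x, r (i + 1) x = x - W.d i (h i x) - h (i + 1) (W.d (i + 1) x) := by
    intro i x; rw [hr]; rfl
  refine ⟨h, r, h0, ?_, ?_, ?_, ?_⟩
  · intro i
    obtain ⟨i, rfl⟩ : ∃ k, i = k + 1 := ⟨i - 1, by omega⟩
    intro x; rw [hr']; exact h1 i x
  · intro i
    obtain ⟨i, rfl⟩ : ∃ k, i = k + 1 := ⟨i - 1, by omega⟩
    intro x hx; rw [hr', h0 _ _ hx, h0 _ _ (hS _ _ hx)]; simp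
  · intro i
    obtain ⟨i, rfl⟩ : ∃ k, i = k + 1 := ⟨i - 1, by omega⟩
    intro x; rw [hr', hr']; simp [hW i, hW (i+1)]
  · intro i x; rw [hr']; abel

section
variable (W : Cx K) (h : ∀ i, W.V (i + 1) →ₗ[K] W.V i) (r : ∀ i, W.V i →ₗ[K] W.V i)

def hpost (n : ℤ) (f : homV W W (n + 1)) : homV W W n := fun j =>
  h (j + n) ∘ₗ castL K W.V (show j + (n + 1) = j + n + 1 by omega) ∘ₗ f j

lemma homD_hpost (hd : ∀ i x, W.d i (h i x) = x - r (i + 1) x - h (i + 1) (W.d (i + 1) x))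
    (n : ℤ) (f : homV W W (n + 1)) (hf : homD W W (n + 1) f = 0) :
    homD W W n (hpost W h n f) = fun j => f j - r _ ∘ₗ f j := by
  funext j
  ext x
  have e := LinearMap.congr_fun (congrFun hf j) x
  rw [homD_app] at e
  change _ = 0 at e
  rw [sgn_succ, neg_smul, sub_neg_eq_add] at e
  have e' := congrArg (fun z => h (j + (n + 1)) (castL K W.V (show _ = j + (n + 1) + 1 by omega) z)) e
  simp only [map_add, map_smul, castL_castL, castL_rfl', map_zero] at e'
  rw [homD_app]
  simp only [hpost, LinearMap.comp_apply, LinearMap.sub_apply, hd, map_sub, d_castL]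
  rw [castL_nat (fun i => i) (fun i => i) r (show j + (n + 1) = j + n + 1 by omega)
      (by omega) (by omega),
    castL_castL, castL_castL, castL_rfl', castL_rfl',
    ← castL_nat (fun i => i + 1) (fun i => i) h (show j + n + 1 = j + (n + 1) by omega)
      (by omega) (by omega),
    ← castL_nat (fun i => i + 1) (fun i => i) h (show j + 1 + n = j + (n + 1) by omega)
      (by omega) (by omega), castL_castL, castL_castL, castL_rfl']
  rw [sub_sub, e', sub_zero]

lemma homD_rpost (hr : ∀ i x, r (i + 1) (W.d i x) = W.d i (r i x))
    (n : ℤ) (f : homV W W n) :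
    homD W W n (fun j => r _ ∘ₗ f j) = fun j => r _ ∘ₗ homD W W n f j := by
  funext j
  ext x
  simp only [LinearMap.comp_apply, homD_app, map_sub, map_smul, ← hr]
  rw [castL_nat (fun i => i) (fun i => i) r (show j + n + 1 = j + (n + 1) by omega)
      (by omega) (by omega),
    castL_nat (fun i => i) (fun i => i) r (show j + 1 + n = j + (n + 1) by omega)
      (by omega) (by omega)]

lemma exists_hpre (S : ∀ i, Submodule K (W.V i)) (h0 : ∀ i, ∀ x ∈ S (i + 1), h i x = 0)
    (hd : ∀ i x, W.d i (h i x) = x - r (i + 1) x - h (i + 1) (W.d (i + 1) x))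
    (n : ℤ) (f : homV W W (n + 1)) (hf : homD W W (n + 1) f = 0) :
    ∃ y : homV W W n, (∀ j, ∀ x ∈ S j, y j x = 0) ∧
      homD W W n y = fun j => f j - f j ∘ₗ r j := by
  obtain ⟨y, hy⟩ := exists_shift (P := fun i => W.V i →ₗ[K] W.V (i + n))
    (fun j => ((-1 : K) ^ (n + 1)) •
      (castL K W.V (show j + (n + 1) = j + 1 + n by omega) ∘ₗ f j ∘ₗ h j))
  refine ⟨y, ?_, ?_⟩
  · intro j
    obtain ⟨j, rfl⟩ : ∃ k, j = k + 1 := ⟨j - 1, by omega⟩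
    intro x hx
    rw [hy]
    simp [h0 _ _ hx]
  · funext j
    obtain ⟨j, rfl⟩ : ∃ k, j = k + 1 := ⟨j - 1, by omega⟩
    ext x
    have e := LinearMap.congr_fun (congrFun hf j) (h j x)
    rw [homD_app] at e
    change _ = 0 at e
    have e' := congrArg (fun z => (castL K W.V (show _ = j + 1 + (n + 1) by omega) z))
      (sub_eq_zero.1 e)
    simp only [map_smul, castL_castL, castL_rfl'] at e'
    rw [homD_app, hy, hy]
    simp only [LinearMap.comp_apply, LinearMap.sub_apply, LinearMap.smul_apply, map_smul, d_castL,
      castL_castL, castL_rfl']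
    rw [e', smul_smul, sgn_sq, one_smul, smul_smul, sgn_succ, mul_neg, sgn_sq, neg_smul, one_smul,
      hd]
    simp only [map_sub]
    abel

variable (S : ∀ i, Submodule K (W.V i)) (hS : ∀ i, ∀ x ∈ S i, W.d i x ∈ S (i + 1))

def extV (hrS : ∀ i x, r i x ∈ S i) (n : ℤ) (g : homV (subCx W S hS) (subCx W S hS) n) :
    homV W W n := fun j =>
  (S (j + n)).subtype ∘ₗ (show S j →ₗ[K] S (j + n) from g j) ∘ₗ (r j).codRestrict (S j) (hrS j)

lemma homD_extV (hrS : ∀ i x, r i x ∈ S i) (hr : ∀ i x, r (i + 1) (W.d i x) = W.d i (r i x))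
    (n : ℤ) (g : homV (subCx W S hS) (subCx W S hS) n) :
    homD W W n (extV W r S hS hrS n g) = extV W r S hS hrS (n + 1) (homD _ _ n g) := by
  funext j
  ext x
  have e : (r (j + 1)).codRestrict (S (j + 1)) (hrS (j + 1)) (W.d j x) =
    (subCx W S hS).d j ((r j).codRestrict (S j) (hrS j) x) := Subtype.ext (hr j x)
  have a : ∀ m (g : homV (subCx W S hS) (subCx W S hS) m) j x, extV W r S hS hrS m g j x =
    Subtype.val (p := (· ∈ S (j + m))) (g j ((r j).codRestrict (S j) (hrS j) x)) := fun _ _ _ _ => rfl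
  rw [homD_app, a, a, a, e]
  refine Eq.symm (Eq.trans (AddSubgroupClass.coe_sub _ _) ?_)
  congr 1
  · exact coe_castL_sub W S hS _ _
  · refine (Submodule.coe_smul _ _).trans ?_
    congr 1
    exact coe_castL_sub W S hS _ _
end

/-- Let `U ⊆ V ⊆ W` be subcomplexes of `W` and `L_{U,V,W} = L_{U,W} ∩ L_{V,W}`.
If the inclusion `V → W` is a quasi-isomorphism, then the inclusion
`L_{U,V,W} → L_{U,W}` and the restriction map `L_{U,V,W} → L_{U,V}`,
`f ↦ f|_V`, are quasi-isomorphisms. -/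
theorem presCx2_quasiIso' (W : Cx K) (hW : W.IsComplex)
    (SU SV : ∀ i, Submodule K (W.V i))
    (hU : ∀ i, ∀ x ∈ SU i, W.d i x ∈ SU (i + 1))
    (hV : ∀ i, ∀ x ∈ SV i, W.d i x ∈ SV (i + 1))
    (hUV : ∀ i, SU i ≤ SV i)
    (hq : IsQuasiIso (subCx W SV hV) W (fun i => (SV i).subtype)) :
    (IsChainMap (presCx2 W SU SV hU hV) (presCx W SU hU)
        (fun n => Submodule.inclusion inf_le_left) ∧
      IsQuasiIso (presCx2 W SU SV hU hV) (presCx W SU hU)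
        (fun n => Submodule.inclusion inf_le_left)) ∧
    (IsChainMap (presCx2 W SU SV hU hV)
        (presCx (subCx W SV hV) (subSub W SU SV hV) (subSub_pres W SU SV hV hU))
        (resMap2 W SU SV hV) ∧
      IsQuasiIso (presCx2 W SU SV hU hV)
        (presCx (subCx W SV hV) (subSub W SU SV hV) (subSub_pres W SU SV hV hU))
        (resMap2 W SU SV hV)) := by
  obtain ⟨h, r, h0, hrS, hri, hr, hd⟩ := exists_hr W hW SV hV hq
  have hres : IsChainMap (presCx2 W SU SV hU hV)
        (presCx (subCx W SV hV) (subSub W SU SV hV) (subSub_pres W SU SV hV hU))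
        (resMap2 W SU SV hV) := by
    intro n f
    apply Subtype.ext; funext j; apply LinearMap.ext; intro x; apply Subtype.ext
    symm
    refine (AddSubgroupClass.coe_sub _ _).trans ?_
    refine Eq.trans ?_ (homD_app W W n f.1 j x.1).symm
    congr 1
    · exact coe_castL_sub W SV hV _ _
    · refine (Submodule.coe_smul _ _).trans ?_
      congr 1
      exact coe_castL_sub W SV hV _ _
  have h0' : ∀ i j (e : i = j + 1), ∀ x ∈ SV i, h j (castL K W.V e x) = 0 := by
    intro i j e x hx; subst e; exact h0 _ _ hx
  refine ⟨⟨fun n f => rfl, fun n => ⟨?_, ?_⟩⟩, hres, fun n => ⟨?_, ?_⟩⟩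
  · rintro ⟨f, hf⟩ hdf ⟨⟨w, hw⟩, hdw⟩
    have hdf' : homD W W (n + 1) f = 0 := congrArg Subtype.val hdf
    have hdw' : homD W W n w = f := congrArg Subtype.val hdw
    have hfU := (Submodule.mem_inf.1 hf).1
    have hfV := (Submodule.mem_inf.1 hf).2
    refine ⟨⟨(fun j => r _ ∘ₗ w j) + hpost W h n f, Submodule.mem_inf.2 ⟨?_, ?_⟩⟩,
      Subtype.ext ?_⟩
    · refine Submodule.add_mem _ ?_ ?_
      · intro j x hx
        have := hw j x hx
        change r _ (w j x) ∈ _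
        rwa [hri _ _ (hUV _ this)]
      · intro j x hx
        change h _ (castL K W.V _ (f j x)) ∈ _
        rw [h0' _ _ _ _ (hUV _ (hfU j x hx))]
        exact Submodule.zero_mem _
    · refine Submodule.add_mem _ ?_ ?_
      · intro j x hx
        exact hrS _ _
      · intro j x hx
        change h _ (castL K W.V _ (f j x)) ∈ _
        rw [h0' _ _ _ _ (hfV j x hx)]
        exact Submodule.zero_mem _
    · change homD W W n ((fun j => r _ ∘ₗ w j) + hpost W h n f) = f
      rw [map_add, homD_rpost W r hr, homD_hpost W h r hd n f hdf', hdw']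
      funext j
      simp
  · rintro ⟨f, hf⟩ hdf
    have hdf' : homD W W (n + 1) f = 0 := congrArg Subtype.val hdf
    refine ⟨⟨fun j => r _ ∘ₗ f j, Submodule.mem_inf.2 ⟨?_, ?_⟩⟩, Subtype.ext ?_,
      ⟨hpost W h n f, ?_⟩, Subtype.ext ?_⟩
    · intro j x hx
      have := hf j x hx
      change r _ (f j x) ∈ _
      rwa [hri _ _ (hUV _ this)]
    · intro j x hx
      exact hrS _ _
    · change homD W W (n + 1) (fun j => r _ ∘ₗ f j) = 0
      rw [homD_rpost W r hr, hdf']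
      funext j
      simp
    · intro j x hx
      change h _ (castL K W.V _ (f j x)) ∈ _
      rw [h0' _ _ _ _ (hUV _ (hf j x hx))]
      exact Submodule.zero_mem _
    · exact homD_hpost W h r hd n f hdf'
  · rintro ⟨f, hf⟩ hdf ⟨⟨w, hw⟩, hdw⟩
    have hdf' : homD W W (n + 1) f = 0 := congrArg Subtype.val hdf
    have hdw' : homD _ _ n w = (resMap2 W SU SV hV (n + 1) ⟨f, hf⟩).1 := congrArg Subtype.val hdw
    obtain ⟨y, hy0, hy⟩ := exists_hpre W h r SV h0 hd n f hdf'
    refine ⟨⟨extV W r SV hV hrS n w + y, Submodule.mem_inf.2 ⟨?_, ?_⟩⟩,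
      Subtype.ext ?_⟩
    · refine Submodule.add_mem _ ?_ ?_
      · intro j x hx
        refine hw j ((r j).codRestrict (SV j) (hrS j) x) ?_
        change r j x ∈ SU j
        rwa [hri _ _ (hUV _ hx)]
      · intro j x hx
        rw [hy0 _ _ (hUV _ hx)]
        exact Submodule.zero_mem _
    · refine Submodule.add_mem _ ?_ ?_
      · intro j x hx
        exact Subtype.property (p := (· ∈ SV (j + n))) _
      · intro j x hx
        rw [hy0 _ _ hx]
        exact Submodule.zero_mem _
    · change homD W W n (extV W r SV hV hrS n w + y) = f
      rw [map_add, homD_extV W r SV hV hrS hr, hy, hdw']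
      funext j
      ext x
      change f j (r j x) + (f j x - f j (r j x)) = f j x
      abel
  · rintro ⟨g, hg⟩ hdg
    have hdg' : homD _ _ (n + 1) g = 0 := congrArg Subtype.val hdg
    refine ⟨⟨extV W r SV hV hrS (n + 1) g, Submodule.mem_inf.2 ⟨?_, ?_⟩⟩, Subtype.ext ?_,
      0, ?_⟩
    · intro j x hx
      refine hg j ((r j).codRestrict (SV j) (hrS j) x) ?_
      change r j x ∈ SU j
      rwa [hri _ _ (hUV _ hx)]
    · intro j x hx
      exact Subtype.property (p := (· ∈ SV (j + (n + 1)))) _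
    · change homD W W (n + 1) (extV W r SV hV hrS (n + 1) g) = 0
      rw [homD_extV W r SV hV hrS hr, hdg']
      funext j
      ext x
      rfl
    · refine (map_zero _).trans (Eq.symm (sub_eq_zero.2 ?_))
      apply Subtype.ext; funext j; apply LinearMap.ext; intro x; apply Subtype.ext
      have : (r j).codRestrict (SV j) (hrS j) x.1 = x := Subtype.ext (hri j x.1 x.2)
      exact congrArg (fun z => Subtype.val (p := (· ∈ SV (j + (n + 1)))) (g j z)) this.symm
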